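/- arXiv:0910.1566 — 3 statements merged into one kernel-verified Lean document; each statement's English description precedes it below -/
import Mathlib

section
/- For all real numbers θ, φ and each j ∈ {1,2,3}, the commutator [ρ_S(φ), ρ_S(θ)] of the two Schmidt density matrices satisfies Tr([ρ_S(φ), ρ_S(θ)]·(σ₀⊗σ_j)) = 0 and Tr([ρ_S(φ), ρ_S(θ)]·(σ_j⊗σ₀)) = 0; equivalently, P([ρ_S(φ), ρ_S(θ)]) = 0, so every Schmidt state is a critical point of the local gradient flow with Schmidt target state. -/
open Matrix Real

noncomputable section

/-- Standard basis vectors of ℂ². -/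
def e0 : Fin 2 → ℂ := ![1, 0]
def e1 : Fin 2 → ℂ := ![0, 1]

/-- First-qubit index of a two-qubit basis label, with basis order
`(e₀⊗e₀, e₀⊗e₁, e₁⊗e₀, e₁⊗e₁)`. -/
def q1 : Fin 4 → Fin 2 := ![0, 0, 1, 1]
/-- Second-qubit index of a two-qubit basis label. -/
def q2 : Fin 4 → Fin 2 := ![0, 1, 0, 1]

/-- Kronecker (tensor) product of two vectors in ℂ², as a vector in ℂ⁴. -/
def vkron (a b : Fin 2 → ℂ) : Fin 4 → ℂ := fun i => a (q1 i) * b (q2 i)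

/-- Kronecker product of two 2×2 matrices, as a 4×4 matrix in the basis
`(e₀⊗e₀, e₀⊗e₁, e₁⊗e₀, e₁⊗e₁)`. -/
def mkron (A B : Matrix (Fin 2) (Fin 2) ℂ) : Matrix (Fin 4) (Fin 4) ℂ :=
  Matrix.of fun i j => A (q1 i) (q1 j) * B (q2 i) (q2 j)

/-- The outer product `|v⟩⟨v|`. -/
def outer (v : Fin 4 → ℂ) : Matrix (Fin 4) (Fin 4) ℂ :=
  Matrix.of fun i j => v i * star (v j)

/-- The two-qubit Schmidt state `ψ_S(θ) = cos(θ/2)·e₀⊗e₀ + sin(θ/2)·e₁⊗e₁`. -/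
def psiS (θ : ℝ) : Fin 4 → ℂ :=
  (Real.cos (θ / 2) : ℂ) • vkron e0 e0 + (Real.sin (θ / 2) : ℂ) • vkron e1 e1

/-- The Schmidt density matrix `ρ_S(θ) = |ψ_S(θ)⟩⟨ψ_S(θ)|`. -/
def rhoS (θ : ℝ) : Matrix (Fin 4) (Fin 4) ℂ := outer (psiS θ)

/-- σ₀, the 2×2 identity. -/
def σ₀ : Matrix (Fin 2) (Fin 2) ℂ := 1
/-- The Pauli matrices σ₁, σ₂, σ₃. -/
def pauli : Fin 3 → Matrix (Fin 2) (Fin 2) ℂ :=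
  ![!![0, 1; 1, 0], !![0, -Complex.I; Complex.I, 0], !![1, 0; 0, -1]]

/-- The projector `P` onto the local (single-qubit) part:
`P(X) = (1/4)·Σ_{j=1}^{3} [Tr(X·(σ₀⊗σ_j))·(σ₀⊗σ_j) + Tr(X·(σ_j⊗σ₀))·(σ_j⊗σ₀)]`. -/
def Pproj (X : Matrix (Fin 4) (Fin 4) ℂ) : Matrix (Fin 4) (Fin 4) ℂ :=
  (1 / 4 : ℂ) • ∑ j : Fin 3,
    ((X * mkron σ₀ (pauli j)).trace • mkron σ₀ (pauli j)
      + (X * mkron (pauli j) σ₀).trace • mkron (pauli j) σ₀)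

/-- The matrix commutator. -/
def matComm (X Y : Matrix (Fin 4) (Fin 4) ℂ) : Matrix (Fin 4) (Fin 4) ℂ := X * Y - Y * X

/-- `a ∈ ℂ²` is a unit vector. -/
def unit2 (a : Fin 2 → ℂ) : Prop := ‖a 0‖ ^ 2 + ‖a 1‖ ^ 2 = 1

/-- The inner product `⟨ψ, v⟩` on ℂ⁴ (conjugate-linear in the first slot). -/
def cinner (ψ v : Fin 4 → ℂ) : ℂ := ∑ i, starRingEnd ℂ (ψ i) * v i

theorem rhoS_explicit (θ : ℝ) : rhoS θ =
    !![(Real.cos (θ / 2) : ℂ) * Real.cos (θ / 2), 0, 0, Real.cos (θ / 2) * Real.sin (θ / 2);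
      0, 0, 0, 0; 0, 0, 0, 0;
      (Real.sin (θ / 2) : ℂ) * Real.cos (θ / 2), 0, 0, Real.sin (θ / 2) * Real.sin (θ / 2)] := by
  ext i j
  fin_cases i <;> fin_cases j <;>
    simp [rhoS, outer, psiS, vkron, e0, e1, q1, q2, -Complex.ofReal_cos, -Complex.ofReal_sin]

theorem comm_explicit (θ φ : ℝ) : ∃ k : ℂ, matComm (rhoS φ) (rhoS θ) =
    !![0, 0, 0, k; 0, 0, 0, 0; 0, 0, 0, 0; -k, 0, 0, 0] := by
  rw [rhoS_explicit, rhoS_explicit]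
  generalize (Real.cos (θ / 2) : ℂ) = a
  generalize (Real.sin (θ / 2) : ℂ) = b
  generalize (Real.cos (φ / 2) : ℂ) = c
  generalize (Real.sin (φ / 2) : ℂ) = d
  refine ⟨(c * a + d * b) * (c * b - a * d), ?_⟩
  ext i j
  fin_cases i <;> fin_cases j <;>
    simp [matComm, Matrix.mul_apply, Fin.sum_univ_four] <;> ring

/-- every Schmidt state is a critical point of the local gradient flow with
Schmidt target state: for all `θ φ` and `j ∈ {1,2,3}`,
`Tr([ρ_S(φ), ρ_S(θ)]·(σ₀⊗σ_j)) = 0`, `Tr([ρ_S(φ), ρ_S(θ)]·(σ_j⊗σ₀)) = 0`, and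
`P([ρ_S(φ), ρ_S(θ)]) = 0`. -/
theorem schmidt_states_are_critical (θ φ : ℝ) :
    (∀ j : Fin 3,
        (matComm (rhoS φ) (rhoS θ) * mkron σ₀ (pauli j)).trace = 0 ∧
        (matComm (rhoS φ) (rhoS θ) * mkron (pauli j) σ₀).trace = 0) ∧
    Pproj (matComm (rhoS φ) (rhoS θ)) = 0 := by
  have key : ∀ j : Fin 3,
        (matComm (rhoS φ) (rhoS θ) * mkron σ₀ (pauli j)).trace = 0 ∧
        (matComm (rhoS φ) (rhoS θ) * mkron (pauli j) σ₀).trace = 0 := by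
    obtain ⟨k, hk⟩ := comm_explicit θ φ
    rw [hk]
    intro j
    fin_cases j <;> constructor <;>
      simp [Matrix.trace, Matrix.mul_apply, Fin.sum_univ_four, mkron, σ₀, pauli, q1, q2,
        Matrix.one_fin_two, Matrix.vecHead, Matrix.vecTail]
  refine ⟨key, ?_⟩
  unfold Pproj
  simp [fun j => (key j).1, fun j => (key j).2]
end
end

section
/- For every θ ∈ [0, π], the supremum over all unit vectors a, b ∈ ℂ² of the product-state fidelity |⟨ψ_S(θ), a⊗b⟩|² equals max(cos²(θ/2), sin²(θ/2)); explicitly, it equals cos²(θ/2) when θ ≤ π/2 and sin²(θ/2) when π/2 < θ ≤ π, and this supremum is attained. -/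
open Matrix Real

noncomputable section

theorem cinner_psiS_vkron (θ : ℝ) (a b : Fin 2 → ℂ) :
    cinner (psiS θ) (vkron a b)
      = (Real.cos (θ / 2) : ℂ) * (a 0 * b 0) + (Real.sin (θ / 2) : ℂ) * (a 1 * b 1) := by
  simp [cinner, psiS, vkron, q1, q2, e0, e1, Fin.sum_univ_four, -Complex.ofReal_cos,
    -Complex.ofReal_sin, Complex.conj_ofReal]

theorem fidelity_le (θ : ℝ) (a b : Fin 2 → ℂ) (ha : unit2 a) (hb : unit2 b) :
    ‖cinner (psiS θ) (vkron a b)‖ ^ 2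
      ≤ max (Real.cos (θ / 2) ^ 2) (Real.sin (θ / 2) ^ 2) := by
  rw [cinner_psiS_vkron]
  unfold unit2 at ha hb
  have h1 := norm_add_le ((Real.cos (θ / 2) : ℂ) * (a 0 * b 0))
    ((Real.sin (θ / 2) : ℂ) * (a 1 * b 1))
  simp only [norm_mul, Complex.norm_real, Real.norm_eq_abs] at h1
  have h2 := pow_le_pow_left₀ (norm_nonneg _) h1 2
  refine h2.trans ?_
  have hc := le_max_left (Real.cos (θ / 2) ^ 2) (Real.sin (θ / 2) ^ 2)
  have hs := le_max_right (Real.cos (θ / 2) ^ 2) (Real.sin (θ / 2) ^ 2)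
  generalize max (Real.cos (θ / 2) ^ 2) (Real.sin (θ / 2) ^ 2) = M at hc hs ⊢
  rw [← sq_abs] at hc hs
  generalize |Real.cos (θ / 2)| = c at *
  generalize |Real.sin (θ / 2)| = s at *
  generalize ‖a 0‖ = p at *
  generalize ‖a 1‖ = p' at *
  generalize ‖b 0‖ = q at *
  generalize ‖b 1‖ = q' at *
  calc (c * (p * q) + s * (p' * q')) ^ 2
      ≤ (c ^ 2 * p ^ 2 + s ^ 2 * p' ^ 2) * (q ^ 2 + q' ^ 2) := by
        nlinarith [sq_nonneg (c * p * q' - s * p' * q)]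
    _ = c ^ 2 * p ^ 2 + s ^ 2 * p' ^ 2 := by rw [hb, mul_one]
    _ ≤ M * p ^ 2 + M * p' ^ 2 := by gcongr
    _ = M := by rw [← mul_add, ha, mul_one]

/-- for `θ ∈ [0, π]`, the supremum over unit vectors `a, b ∈ ℂ²` of the
product-state fidelity `|⟨ψ_S(θ), a⊗b⟩|²` equals `max(cos²(θ/2), sin²(θ/2))` and is
attained; explicitly it is `cos²(θ/2)` for `θ ≤ π/2` and `sin²(θ/2)` for `π/2 < θ ≤ π`. -/
theorem max_product_fidelity_of_schmidt (θ : ℝ) (h0 : 0 ≤ θ) (hπ : θ ≤ π) :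
    IsGreatest
      {r : ℝ | ∃ a b : Fin 2 → ℂ, unit2 a ∧ unit2 b ∧
        r = ‖cinner (psiS θ) (vkron a b)‖ ^ 2}
      (max (Real.cos (θ / 2) ^ 2) (Real.sin (θ / 2) ^ 2)) ∧
    (θ ≤ π / 2 →
      max (Real.cos (θ / 2) ^ 2) (Real.sin (θ / 2) ^ 2) = Real.cos (θ / 2) ^ 2) ∧
    (π / 2 < θ →
      max (Real.cos (θ / 2) ^ 2) (Real.sin (θ / 2) ^ 2) = Real.sin (θ / 2) ^ 2) := by
  have hd : Real.cos θ = Real.cos (θ / 2) ^ 2 - Real.sin (θ / 2) ^ 2 := by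
    have := Real.cos_two_mul' (θ / 2)
    rwa [mul_div_cancel₀ θ (two_ne_zero)] at this
  refine ⟨⟨?_, ?_⟩, ?_, ?_⟩
  · rcases max_choice (Real.cos (θ / 2) ^ 2) (Real.sin (θ / 2) ^ 2) with h | h
    · rw [h]
      refine ⟨e0, e0, by simp [unit2, e0], by simp [unit2, e0], ?_⟩
      rw [cinner_psiS_vkron]
      simp [e0, -Complex.ofReal_cos]
    · rw [h]
      refine ⟨e1, e1, by simp [unit2, e1], by simp [unit2, e1], ?_⟩
      rw [cinner_psiS_vkron]
      simp [e1, -Complex.ofReal_sin]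
  · rintro r ⟨a, b, ha, hb, rfl⟩
    exact fidelity_le θ a b ha hb
  · intro h
    have := Real.cos_nonneg_of_neg_pi_div_two_le_of_le (by linarith [Real.pi_pos]) h
    exact max_eq_left (by linarith)
  · intro h
    have := Real.cos_nonpos_of_pi_div_two_le_of_le h.le (by linarith [Real.pi_pos])
    exact max_eq_right (by linarith)
end
end

section
/- Let θ, φ ∈ (0, π) with θ ≠ π/2 and φ ≠ π/2, and define g(φ) = −1 − cos(θ−φ) + sin θ + sin φ. Then g(φ)·g(π−φ) < 0; that is, the last Hessian eigenvalue entry has strictly opposite signs at the critical states ρ_S(φ) and ρ_S(π−φ), so for each critical Schmidt state with negative spectrum there is a paired one with mixed spectrum and conversely. -/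
open Real

/-- for `θ, φ ∈ (0, π)` with `θ ≠ π/2`, `φ ≠ π/2`, the Hessian eigenvalue
entry `g(φ) = −1 − cos(θ−φ) + sin θ + sin φ` has strictly opposite signs at the paired
critical Schmidt states `ρ_S(φ)` and `ρ_S(π−φ)`: `g(φ)·g(π−φ) < 0`. -/
theorem hessian_entry_opposite_signs (θ φ : ℝ)
    (hθ0 : 0 < θ) (hθπ : θ < π) (hθ : θ ≠ π / 2)
    (hφ0 : 0 < φ) (hφπ : φ < π) (hφ : φ ≠ π / 2) :
    (-1 - Real.cos (θ - φ) + Real.sin θ + Real.sin φ) *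
      (-1 - Real.cos (θ - (π - φ)) + Real.sin θ + Real.sin (π - φ)) < 0 := by
  have key : ∀ x : ℝ, 0 < x → x < π → x ≠ π / 2 → 0 < 1 - Real.sin x := by
    intro x h0 h1 h2
    have hc : Real.cos x ≠ 0 := by
      intro h
      apply h2
      apply Real.injOn_cos ⟨h0.le, h1.le⟩ ⟨by linarith, by linarith⟩
      rw [h, Real.cos_pi_div_two]
    have h3 : 0 < Real.cos x ^ 2 := by positivity
    have h4 := Real.sin_sq_add_cos_sq x
    nlinarith [Real.sin_pos_of_pos_of_lt_pi h0 h1]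
  have a := key θ hθ0 hθπ hθ
  have b := key φ hφ0 hφπ hφ
  have sa := Real.sin_pos_of_pos_of_lt_pi hθ0 hθπ
  have sb := Real.sin_pos_of_pos_of_lt_pi hφ0 hφπ
  have e1 : Real.cos θ ^ 2 = 1 - Real.sin θ ^ 2 := Real.cos_sq' θ
  have e2 : Real.cos φ ^ 2 = 1 - Real.sin φ ^ 2 := Real.cos_sq' φ
  have p : 0 < (1 - Real.sin θ) * (1 - Real.sin φ) * (2 * (Real.sin θ + Real.sin φ)) := by
    positivity
  rw [Real.cos_sub, Real.cos_sub, Real.cos_pi_sub, Real.sin_pi_sub]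
  have e : (-1 - (Real.cos θ * Real.cos φ + Real.sin θ * Real.sin φ) + Real.sin θ + Real.sin φ) *
      (-1 - (Real.cos θ * -Real.cos φ + Real.sin θ * Real.sin φ) + Real.sin θ + Real.sin φ)
      = -((1 - Real.sin θ) * (1 - Real.sin φ) * (2 * (Real.sin θ + Real.sin φ))) := by
    linear_combination (-Real.cos φ ^ 2) * e1 - (1 - Real.sin θ ^ 2) * e2
  rw [e]
  linarith
end
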